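/- Let (λ_n) and (μ_n) be real sequences for which there exists a bijection π : ℕ → ℕ with |λ_{π(n)} − μ_n| → 0 as n → ∞. Then the diagonal self-adjoint operators diag(λ) and diag(μ) on ℓ²(ℕ, ℂ) are Weyl–von Neumann equivalent: there exist a unitary u on ℓ²(ℕ, ℂ) and a compact self-adjoint operator K with u diag(λ) u* + K = diag(μ). -/

import Mathlib

open Filter Metric Topology

noncomputable section

variable {ι : Type*}

/-- The domain of the diagonal operator. -/
def diagDomain (c : ι → ℝ) : Submodule ℂ (lp (fun _ : ι => ℂ) 2) where
  carrier := {x | Memℓp (fun n => (c n : ℂ) * x n) 2}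
  add_mem' := by
    intro x y hx hy
    show Memℓp _ 2
    have h := hx.add hy
    convert h using 1
    funext n
    simp [lp.coeFn_add, Pi.add_apply, mul_add]
  zero_mem' := by
    show Memℓp _ 2
    have h : Memℓp (0 : ∀ _ : ι, ℂ) 2 := zero_memℓp
    convert h using 1
    funext n
    simp
  smul_mem' := by
    intro a x hx
    show Memℓp _ 2
    have h := hx.const_smul a
    convert h using 1
    funext n
    simp [lp.coeFn_smul, Pi.smul_apply]
    ring

/-- The diagonal operator `diag c` on `ℓ²`. -/
def diag (c : ι → ℝ) : lp (fun _ : ι => ℂ) 2 →ₗ.[ℂ] lp (fun _ : ι => ℂ) 2 where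
  domain := diagDomain c
  toFun :=
    { toFun := fun x => ⟨fun n => (c n : ℂ) * (x : lp (fun _ : ι => ℂ) 2) n, x.2⟩
      map_add' := by
        intro x y
        apply Subtype.ext
        funext n
        simp [lp.coeFn_add, Pi.add_apply, mul_add]
        rfl
      map_smul' := by
        intro a x
        apply Subtype.ext
        funext n
        simp [lp.coeFn_smul, Pi.smul_apply]
        ring }

end

noncomputable section

variable {H : Type*} [NormedAddCommGroup H] [InnerProductSpace ℂ H] [CompleteSpace H]

/-- Weyl-von Neumann equivalence. -/
def WvNEquiv (A B : H →ₗ.[ℂ] H) : Prop :=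
  ∃ (u : H ≃ₗᵢ[ℂ] H) (K : H →L[ℂ] H), IsCompactOperator K ∧ IsSelfAdjoint K ∧
    B.domain = A.domain.map (u.toLinearEquiv : H →ₗ[ℂ] H) ∧
    ∀ (x : A.domain) (hx : u (x : H) ∈ B.domain), B ⟨u (x : H), hx⟩ = u (A x) + K (u (x : H))

end

noncomputable section

theorem lp.norm_le_mul_of_norm_apply_le {ι : Type*} {C : ℝ} (hC : 0 ≤ C)
    {x y : lp (fun _ : ι => ℂ) 2} (h : ∀ i, ‖y i‖ ≤ C * ‖x i‖) : ‖y‖ ≤ C * ‖x‖ := by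
  have hnorm : ‖(C : ℂ)‖ = C := by rw [Complex.norm_real, Real.norm_of_nonneg hC]
  have hle : ‖y‖ ≤ ‖(C : ℂ) • x‖ := by
    refine lp.norm_mono (by norm_num) fun i => ?_
    rw [lp.coeFn_smul, Pi.smul_apply, norm_smul, hnorm]
    exact h i
  rwa [norm_smul, hnorm] at hle

theorem mem_diagDomain_of_bounded {ι : Type*} {d : ι → ℝ} {C : ℝ} (hd : ∀ i, |d i| ≤ C)
    (x : lp (fun _ : ι => ℂ) 2) : x ∈ diagDomain d := by
  refine ((lp.memℓp x).const_smul (C : ℂ)).mono' fun i => ?_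
  have hC : |d i| ≤ |C| := (hd i).trans (le_abs_self C)
  simpa using mul_le_mul_of_nonneg_right hC (norm_nonneg (x i))

/-- The bounded diagonal operator with a bounded real symbol. -/
def diagCLM {ι : Type*} (d : ι → ℝ) (C : ℝ) (hC : 0 ≤ C) (hd : ∀ i, |d i| ≤ C) :
    lp (fun _ : ι => ℂ) 2 →L[ℂ] lp (fun _ : ι => ℂ) 2 :=
  LinearMap.mkContinuous
    ((diag d).toFun ∘ₗ LinearMap.id.codRestrict (diagDomain d) (mem_diagDomain_of_bounded hd)) C
    fun x => lp.norm_le_mul_of_norm_apply_le hC fun i => by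
      change ‖(d i : ℂ) * x i‖ ≤ _
      rw [norm_mul, Complex.norm_real, Real.norm_eq_abs]
      gcongr
      exact hd i

theorem diagCLM_apply {ι : Type*} (d : ι → ℝ) (C : ℝ) (hC : 0 ≤ C) (hd : ∀ i, |d i| ≤ C)
    (x : lp (fun _ : ι => ℂ) 2) (i : ι) : diagCLM d C hC hd x i = (d i : ℂ) * x i := rfl

theorem isSelfAdjoint_diagCLM {ι : Type*} (d : ι → ℝ) (C : ℝ) (hC : 0 ≤ C)
    (hd : ∀ i, |d i| ≤ C) : IsSelfAdjoint (diagCLM d C hC hd) := by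
  rw [ContinuousLinearMap.isSelfAdjoint_iff_isSymmetric]
  intro x y
  change inner ℂ (diagCLM d C hC hd x) y = inner ℂ x (diagCLM d C hC hd y)
  rw [lp.inner_eq_tsum, lp.inner_eq_tsum]
  refine tsum_congr fun i => ?_
  simp only [diagCLM_apply, RCLike.inner_apply, map_mul, Complex.conj_ofReal]
  ring

theorem isCompactOperator_diagCLM (d : ℕ → ℝ) (C : ℝ) (hC : 0 ≤ C) (hd : ∀ i, |d i| ≤ C)
    (h : Tendsto d atTop (𝓝 0)) : IsCompactOperator (diagCLM d C hC hd) := by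
  let P : ℕ → lp (fun _ : ℕ => ℂ) 2 →L[ℂ] lp (fun _ : ℕ => ℂ) 2 := fun i =>
    (lp.singleContinuousLinearMap ℂ (fun _ : ℕ => ℂ) 2 i).comp
      (lp.evalCLM ℂ (fun _ : ℕ => ℂ) 2 i)
  have hP : ∀ i, P i ∈ compactOperator (RingHom.id ℂ) (lp (fun _ : ℕ => ℂ) 2)
      (lp (fun _ : ℕ => ℂ) 2) := fun i =>
    (isCompactOperator_of_locallyCompactSpace_rng
      (lp.singleContinuousLinearMap ℂ (fun _ : ℕ => ℂ) 2 i)).comp_clm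
      (lp.evalCLM ℂ (fun _ : ℕ => ℂ) 2 i)
  let F : ℕ → lp (fun _ : ℕ => ℂ) 2 →L[ℂ] lp (fun _ : ℕ => ℂ) 2 := fun N =>
    ∑ i ∈ Finset.range N, (d i : ℂ) • P i
  have hF : ∀ N, IsCompactOperator (F N) := fun N =>
    (compactOperator (RingHom.id ℂ) (lp (fun _ : ℕ => ℂ) 2) (lp (fun _ : ℕ => ℂ) 2)).sum_mem
      fun i _ => Submodule.smul_mem _ _ (hP i)
  have hF_apply : ∀ N x j, F N x j = if j < N then (d j : ℂ) * x j else 0 := by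
    intro N x j
    have hP_apply : ∀ i, ((d i : ℂ) • P i) x j = if j = i then (d i : ℂ) * x i else 0 := by
      intro i
      change (d i : ℂ) * lp.single (E := fun _ : ℕ => ℂ) 2 i (x i) j = _
      rw [lp.single_apply, Pi.single_apply, mul_ite, mul_zero]
    simp only [F, sum_apply, lp.coeFn_sum, Finset.sum_apply, hP_apply,
      Finset.sum_ite_eq, Finset.mem_range]
  refine isCompactOperator_of_tendsto (l := atTop) (F := F) ?_ (.of_forall hF)
  rw [Metric.tendsto_atTop] at h ⊢
  intro ε hε
  obtain ⟨N, hN⟩ := h (ε / 2) (half_pos hε)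
  refine ⟨N, fun n hn => lt_of_le_of_lt ?_ (half_lt_self hε)⟩
  rw [dist_eq_norm]
  refine ContinuousLinearMap.opNorm_le_bound _ (half_pos hε).le fun x =>
    lp.norm_le_mul_of_norm_apply_le (half_pos hε).le fun j => ?_
  rw [sub_apply, lp.coeFn_sub, Pi.sub_apply, hF_apply, diagCLM_apply]
  split_ifs with hj
  · simp only [sub_self, norm_zero]
    positivity
  · have hdj := hN j (hn.trans (not_lt.mp hj))
    rw [Real.dist_eq, sub_zero] at hdj
    rw [zero_sub, norm_neg, norm_mul, Complex.norm_real, Real.norm_eq_abs]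
    gcongr

theorem Memℓp.comp_equiv {ι κ : Type*} {f : ι → ℂ} (hf : Memℓp f 2) (e : κ ≃ ι) :
    Memℓp (fun k => f (e k)) 2 :=
  memℓp_gen ((e.summable_iff (f := fun i => ‖f i‖ ^ (2 : ENNReal).toReal)).mpr
    (hf.summable (by norm_num)))

/-- Reindexing along a bijection as a unitary between `ℓ²` spaces. -/
def lpReindex {ι κ : Type*} (e : κ ≃ ι) :
    lp (fun _ : ι => ℂ) 2 ≃ₗᵢ[ℂ] lp (fun _ : κ => ℂ) 2 where
  toFun x := ⟨fun k => x (e k), (lp.memℓp x).comp_equiv e⟩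
  invFun y := ⟨fun i => y (e.symm i), (lp.memℓp y).comp_equiv e.symm⟩
  map_add' _ _ := rfl
  map_smul' _ _ := rfl
  left_inv x := by
    ext i
    exact congrArg x (e.apply_symm_apply i)
  right_inv y := by
    ext k
    exact congrArg y (e.symm_apply_apply k)
  norm_map' x := by
    rw [lp.norm_eq_tsum_rpow (by norm_num), lp.norm_eq_tsum_rpow (by norm_num)]
    congr 1
    exact e.tsum_eq fun i => ‖x i‖ ^ (2 : ENNReal).toReal

theorem lpReindex_apply {ι κ : Type*} (e : κ ≃ ι) (x : lp (fun _ : ι => ℂ) 2) (k : κ) :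
    lpReindex e x k = x (e k) := rfl

theorem mem_diagDomain_lpReindex {ι κ : Type*} (e : κ ≃ ι) (c : ι → ℝ)
    (x : lp (fun _ : ι => ℂ) 2) :
    lpReindex e x ∈ diagDomain (fun k => c (e k)) ↔ x ∈ diagDomain c := by
  refine ⟨fun hx => ?_, fun hx => Memℓp.comp_equiv hx e⟩
  have hx' := Memℓp.comp_equiv hx e.symm
  simp only [lpReindex_apply, e.apply_symm_apply] at hx'
  exact hx'

theorem diagDomain_le_of_bounded_sub {ι : Type*} {b c : ι → ℝ} {C : ℝ}
    (h : ∀ i, |c i - b i| ≤ C) : diagDomain b ≤ diagDomain c := by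
  intro x hx
  have hs := Memℓp.add hx (mem_diagDomain_of_bounded h x)
  change Memℓp _ 2
  convert hs using 1
  funext i
  simp only [Pi.add_apply]
  push_cast
  ring

theorem wvnEquiv_diag_of_bijection (l m : ℕ → ℝ) (π : ℕ → ℕ) (hπ : Function.Bijective π)
    (h : Tendsto (fun n => |l (π n) - m n|) atTop (𝓝 0)) :
    WvNEquiv (diag l) (diag m) := by
  let e := Equiv.ofBijective π hπ
  let d : ℕ → ℝ := fun n => m n - l (π n)
  have hd0 : Tendsto d atTop (𝓝 0) := by
    rw [tendsto_zero_iff_abs_tendsto_zero]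
    simpa only [Function.comp_def, d, abs_sub_comm] using h
  obtain ⟨C, hC⟩ := hd0.norm.bddAbove_range
  have hd : ∀ n, |d n| ≤ C := fun n => hC ⟨n, rfl⟩
  have hC0 : 0 ≤ C := (abs_nonneg _).trans (hd 0)
  have hdom : diagDomain m = diagDomain (fun n => l (e n)) :=
    le_antisymm
      (diagDomain_le_of_bounded_sub fun n => (abs_sub_comm (l (π n)) (m n)).trans_le (hd n))
      (diagDomain_le_of_bounded_sub hd)
  refine ⟨lpReindex e, diagCLM d C hC0 hd, isCompactOperator_diagCLM d C hC0 hd hd0,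
    isSelfAdjoint_diagCLM d C hC0 hd, ?_, fun x hx => ?_⟩
  · change diagDomain m = (diagDomain l).map _
    rw [hdom]
    ext y
    constructor
    · intro hy
      refine ⟨(lpReindex e).symm y, (mem_diagDomain_lpReindex e l _).mp ?_,
        (lpReindex e).apply_symm_apply y⟩
      rwa [LinearIsometryEquiv.apply_symm_apply]
    · rintro ⟨x, hx, rfl⟩
      exact (mem_diagDomain_lpReindex e l x).mpr hx
  · ext n
    change (m n : ℂ) * (x : lp (fun _ : ℕ => ℂ) 2) (π n)
      = (l (π n) : ℂ) * (x : lp (fun _ : ℕ => ℂ) 2) (π n)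
        + ((m n - l (π n) : ℝ) : ℂ) * (x : lp (fun _ : ℕ => ℂ) 2) (π n)
    push_cast
    ring

end
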